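/- For every prime p and integer a₂ with α = v_p(a₂), the local Fourier transform of the height at s = 2 satisfies Ĥ_p(2; 0, a₂) = (1 + 1/p + 1/p²)(1 − 1/p^{2+2α}). -/

import Mathlib

open MeasureTheory

namespace Padic

variable {p : ℕ} [Fact p.Prime]

theorem exists_pow_eq_max_one_norm (y : ℚ_[p]) : ∃ k : ℕ, max 1 ‖y‖ = (p : ℝ) ^ k := by
  have hp : (1 : ℝ) ≤ p := by exact_mod_cast (Fact.out : p.Prime).one_le
  by_cases h : ‖y‖ ≤ 1
  · exact ⟨0, by simp [h]⟩
  · have hy : y ≠ 0 := by rintro rfl; simp at h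
    have hn := norm_eq_zpow_neg_valuation hy
    push Not at h
    have hv : 0 ≤ -y.valuation := by
      by_contra! hneg
      exact absurd (hn ▸ h) (not_lt.2 (zpow_le_one_of_nonpos₀ hp hneg.le))
    obtain ⟨k, hk⟩ := Int.eq_ofNat_of_zero_le hv
    exact ⟨k, by rw [max_eq_right h.le, hn, hk, zpow_natCast]⟩

theorem max_one_norm_height (x y : ℚ_[p]) :
    max (max 1 ‖x‖) (max ‖y‖ ‖x * y - y ^ 3‖) =
      max 1 ‖y‖ * max (max 1 ‖y‖) ‖x - y ^ 2‖ := by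
  have h3 : ‖x * y - y ^ 3‖ = ‖y‖ * ‖x - y ^ 2‖ := by rw [← norm_mul]; congr 1; ring
  have hx : ‖x‖ ≤ max ‖x - y ^ 2‖ (‖y‖ ^ 2) := by
    have := nonarchimedean (x - y ^ 2) (y ^ 2)
    rwa [sub_add_cancel, norm_pow] at this
  have hu : ‖x - y ^ 2‖ ≤ max ‖x‖ (‖y‖ ^ 2) := by
    have := nonarchimedean x (-y ^ 2)
    rwa [norm_neg, ← sub_eq_add_neg, norm_pow] at this
  have hyy : ‖y‖ ^ 2 ≤ max ‖x‖ ‖x - y ^ 2‖ := by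
    have := nonarchimedean x (-(x - y ^ 2))
    rwa [norm_neg, ← sub_eq_add_neg, sub_sub_cancel, norm_pow] at this
  have hu0 := norm_nonneg (x - y ^ 2)
  have hy0 := norm_nonneg y
  rw [h3]
  generalize ‖x - y ^ 2‖ = u at *
  generalize ‖x‖ = X at *
  generalize ‖y‖ = Y at *
  rcases le_or_gt Y 1 with h | h
  · have hY2 : Y ^ 2 ≤ 1 := by nlinarith
    have hYu : Y * u ≤ u := by nlinarith
    rw [max_eq_left h, one_mul]
    apply le_antisymm
    · refine max_le (max_le (le_max_left _ _) ?_) (max_le (h.trans (le_max_left _ _)) ?_)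
      · exact hx.trans (max_le (le_max_right _ _) (hY2.trans (le_max_left _ _)))
      · exact hYu.trans (le_max_right _ _)
    · refine max_le (by simp) (hu.trans (max_le (by simp) (hY2.trans (by simp))))
  · rw [max_eq_right h.le, mul_max_of_nonneg _ _ hy0]
    apply le_antisymm
    · have hYY : Y ≤ Y * Y := by nlinarith
      have huY : u ≤ Y * u := by nlinarith
      refine max_le (max_le ?_ (hx.trans (max_le ?_ ?_))) (max_le ?_ (le_max_right _ _))
      · exact (h.le.trans hYY).trans (le_max_left _ _)
      · exact huY.trans (le_max_right _ _)
      · exact (pow_two Y).le.trans (le_max_left _ _)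
      · exact hYY.trans (le_max_left _ _)
    · refine max_le ?_ (by simp)
      rw [← pow_two]
      refine hyy.trans (max_le (by simp) ?_)
      have huY : u ≤ Y * u := by nlinarith
      exact huY.trans (by simp)

section AddChar

variable {ψ : AddChar ℚ_[p] ℂ} (hψ : ∀ x : ℚ_[p], ‖x‖ ≤ 1 → ψ x = 1)
include hψ

theorem norm_addChar_eq_one (x : ℚ_[p]) : ‖ψ x‖ = 1 := by
  obtain ⟨k, hk⟩ := exists_pow_eq_max_one_norm x
  have hp : 0 < p := (Fact.out : p.Prime).pos
  refine Complex.norm_eq_one_of_pow_eq_one (n := p ^ k) ?_ (pow_pos hp k).ne'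
  rw [← AddChar.map_nsmul_eq_pow]
  apply hψ
  have hp' : (0 : ℝ) < (p : ℝ) ^ k := by positivity
  rw [nsmul_eq_mul, norm_mul, Nat.cast_pow, norm_pow, norm_p, inv_pow,
    inv_mul_le_iff₀ hp', mul_one, ← hk]
  exact le_max_right _ _

theorem continuous_addChar : Continuous ψ := by
  refine continuous_iff_continuousAt.2 fun x ↦ ?_
  refine (continuousAt_const (y := ψ x)).congr ?_
  filter_upwards [Metric.closedBall_mem_nhds x one_pos] with y hy
  rw [Metric.mem_closedBall, dist_eq_norm] at hy
  rw [← sub_add_cancel y x, AddChar.map_add_eq_mul, hψ _ hy, one_mul]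

end AddChar

theorem norm_le_pow_succ_iff (x : ℚ_[p]) (k : ℕ) :
    ‖x‖ ≤ (p : ℝ) ^ (k + 1) ↔
      ∃ i ∈ Finset.range p, ‖x - i * ((p : ℚ_[p]) ^ (k + 1))⁻¹‖ ≤ (p : ℝ) ^ k := by
  have hp : (0 : ℝ) < p := by exact_mod_cast (Fact.out : p.Prime).pos
  have hp1 : (1 : ℝ) ≤ p := by exact_mod_cast (Fact.out : p.Prime).one_le
  have hp0 : (p : ℚ_[p]) ≠ 0 := by exact_mod_cast (Fact.out : p.Prime).ne_zero
  constructor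
  · intro h
    have hw : ‖x * (p : ℚ_[p]) ^ (k + 1)‖ ≤ 1 := by
      rw [norm_mul, norm_pow, norm_p, inv_pow, mul_inv_le_iff₀ (by positivity), one_mul]
      exact h
    let w : ℤ_[p] := ⟨_, hw⟩
    refine ⟨w.zmodRepr, Finset.mem_range.2 w.zmodRepr_lt_p, ?_⟩
    have h1 : ‖(x * (p : ℚ_[p]) ^ (k + 1)) - w.zmodRepr‖ < (p : ℝ) ^ (-1 + 1 : ℤ) := by
      have := w.norm_sub_zmodRepr_lt_one
      rw [PadicInt.norm_def, PadicInt.coe_sub, PadicInt.coe_natCast] at this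
      simpa only [neg_add_cancel, zpow_zero] using this
    rw [← norm_le_pow_iff_norm_lt_pow_add_one] at h1
    have h2 : x - (w.zmodRepr : ℚ_[p]) * ((p : ℚ_[p]) ^ (k + 1))⁻¹ =
        (x * (p : ℚ_[p]) ^ (k + 1) - (w.zmodRepr : ℚ_[p])) * ((p : ℚ_[p]) ^ (k + 1))⁻¹ := by
      field_simp
    rw [h2, norm_mul, norm_inv, norm_pow, norm_p, inv_pow, inv_inv]
    calc _ ≤ (p : ℝ) ^ (-1 : ℤ) * (p : ℝ) ^ (k + 1) := by gcongr
      _ = (p : ℝ) ^ k := by rw [zpow_neg_one, pow_succ]; field_simp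
  · rintro ⟨i, -, hi⟩
    have h := nonarchimedean (x - (i : ℚ_[p]) * ((p : ℚ_[p]) ^ (k + 1))⁻¹)
      ((i : ℚ_[p]) * ((p : ℚ_[p]) ^ (k + 1))⁻¹)
    rw [sub_add_cancel] at h
    refine h.trans (max_le (hi.trans (pow_le_pow_right₀ hp1 k.le_succ)) ?_)
    rw [norm_mul, norm_inv, norm_pow, norm_p, inv_pow, inv_inv]
    have : ‖(i : ℚ_[p])‖ ≤ 1 := by simpa using norm_int_le_one (p := p) i
    exact mul_le_of_le_one_left (by positivity) this

variable [MeasurableSpace ℚ_[p]] [BorelSpace ℚ_[p]]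
  (μ : Measure ℚ_[p]) [μ.IsAddHaarMeasure]

theorem measurableSet_norm_le (r : ℝ) : MeasurableSet {x : ℚ_[p] | ‖x‖ ≤ r} :=
  measurableSet_le measurable_norm measurable_const

theorem measure_norm_le_pow (hμ : μ {x : ℚ_[p] | ‖x‖ ≤ 1} = 1) (k : ℕ) :
    μ {x : ℚ_[p] | ‖x‖ ≤ (p : ℝ) ^ k} = (p : ENNReal) ^ k := by
  have hp : (0 : ℝ) < p := by exact_mod_cast (Fact.out : p.Prime).pos
  induction k with
  | zero => simpa using hμ
  | succ k ih =>
    have hset : {x : ℚ_[p] | ‖x‖ ≤ (p : ℝ) ^ (k + 1)} = ⋃ i ∈ Finset.range p,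
        (fun x ↦ x + -((i : ℚ_[p]) * ((p : ℚ_[p]) ^ (k + 1))⁻¹)) ⁻¹'
          {x : ℚ_[p] | ‖x‖ ≤ (p : ℝ) ^ k} := by
      ext x
      simp only [Set.mem_ofPred_eq, norm_le_pow_succ_iff, Set.mem_iUnion, Set.mem_preimage,
        sub_eq_add_neg, exists_prop]
    rw [hset, measure_biUnion_finset]
    · simp only [measure_preimage_add_right, ih, Finset.sum_const, Finset.card_range,
        nsmul_eq_mul, pow_succ, mul_comm]
    · intro i hi j hj hij
      refine Set.disjoint_left.2 fun x hx hy ↦ hij ?_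
      simp only [Set.mem_preimage, Set.mem_ofPred_eq] at hx hy
      have h := nonarchimedean (x + -((i : ℚ_[p]) * ((p : ℚ_[p]) ^ (k + 1))⁻¹))
        (-(x + -((j : ℚ_[p]) * ((p : ℚ_[p]) ^ (k + 1))⁻¹)))
      rw [norm_neg] at h
      replace h := h.trans (max_le hx hy)
      have h2 : x + -((i : ℚ_[p]) * ((p : ℚ_[p]) ^ (k + 1))⁻¹) +
          -(x + -((j : ℚ_[p]) * ((p : ℚ_[p]) ^ (k + 1))⁻¹)) =
        (((j - i : ℤ) : ℚ_[p])) * ((p : ℚ_[p]) ^ (k + 1))⁻¹ := by push_cast; ring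
      rw [h2, norm_mul, norm_inv, norm_pow, norm_p, inv_pow, inv_inv, pow_succ, mul_comm,
        mul_assoc, mul_le_iff_le_one_right (by positivity), ← le_div_iff₀' hp] at h
      have h3 : (p : ℤ) ∣ j - i := by
        have := (norm_int_le_pow_iff_dvd (p := p) (j - i) 1).1 (by simpa using h)
        simpa using this
      simp only [Finset.coe_range, Set.mem_Iio] at hi hj
      have := Int.eq_zero_of_abs_lt_dvd h3 (by rw [abs_lt]; omega)
      omega
    · intro i _
      exact (measurable_add_const _) (measurableSet_norm_le _)

theorem integral_norm_le_pow_one (hμ : μ {x : ℚ_[p] | ‖x‖ ≤ 1} = 1) (m : ℕ) :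
    ∫ _ in {x : ℚ_[p] | ‖x‖ ≤ (p : ℝ) ^ m}, (1 : ℂ) ∂μ = (p : ℂ) ^ m := by
  rw [setIntegral_const, measureReal_def, measure_norm_le_pow μ hμ]
  simp

omit [Fact p.Prime] in
theorem hasSum_inv_max_pow (hp : 1 < p) {n : ℕ} (hn : n ≠ 0) (k m : ℕ) :
    HasSum (fun j ↦ if m ≤ k + j then ((p : ℂ)⁻¹ ^ n) ^ (k + j) * (1 - (p : ℂ)⁻¹ ^ n) else 0)
      ((((max ((p : ℝ) ^ k) ((p : ℝ) ^ m) : ℝ) : ℂ) ^ n)⁻¹) := by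
  have hp1 : (1 : ℝ) < p := by exact_mod_cast hp
  have hq : ‖(p : ℂ)⁻¹ ^ n‖ < 1 := by
    rw [norm_pow, norm_inv, Complex.norm_natCast]
    exact pow_lt_one₀ (by positivity) (inv_lt_one_of_one_lt₀ hp1) hn
  have hq1 : 1 - (p : ℂ)⁻¹ ^ n ≠ 0 := by
    intro h
    rw [← sub_eq_zero.1 h] at hq
    simp at hq
  have hmax : max ((p : ℝ) ^ k) ((p : ℝ) ^ m) = (p : ℝ) ^ (k + (m - k)) := by
    rcases le_total k m with h | h
    · rw [max_eq_right (pow_le_pow_right₀ hp1.le h)]; congr 1; omega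
    · rw [max_eq_left (pow_le_pow_right₀ hp1.le h)]; congr 1; omega
  have hs : HasSum (fun j ↦ ((p : ℂ)⁻¹ ^ n) ^ (k + (m - k)) * (1 - (p : ℂ)⁻¹ ^ n) *
      ((p : ℂ)⁻¹ ^ n) ^ j) ((((p : ℝ) ^ (k + (m - k)) : ℝ) : ℂ) ^ n)⁻¹ := by
    convert! (hasSum_geometric_of_norm_lt_one hq).mul_left _ using 1
    rw [mul_assoc, mul_inv_cancel₀ hq1, mul_one]
    push_cast
    rw [← inv_pow, ← inv_pow, ← pow_mul, ← pow_mul, mul_comm]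
  rw [hmax]
  have h0 : ∑ i ∈ Finset.range (m - k), (if m ≤ k + i then
      ((p : ℂ)⁻¹ ^ n) ^ (k + i) * (1 - (p : ℂ)⁻¹ ^ n) else 0) = 0 := by
    refine Finset.sum_eq_zero fun i hi ↦ if_neg ?_
    have := Finset.mem_range.1 hi
    omega
  have hiff := hasSum_nat_add_iff (m - k) (g := ((((p : ℝ) ^ (k + (m - k)) : ℝ) : ℂ) ^ n)⁻¹)
    (f := fun j ↦ if m ≤ k + j then ((p : ℂ)⁻¹ ^ n) ^ (k + j) * (1 - (p : ℂ)⁻¹ ^ n) else 0)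
  rw [h0, add_zero] at hiff
  rw [← hiff]
  refine hs.congr_fun fun j ↦ ?_
  rw [if_pos (by omega), show k + (j + (m - k)) = k + (m - k) + j by ring, pow_add _ _ j]
  ring

variable {μ} in
theorem hasSum_integral_inv_max_pow_mul (hμ : μ {x : ℚ_[p] | ‖x‖ ≤ 1} = 1) {n : ℕ} (hn : 2 ≤ n)
    (k : ℕ) {φ : ℚ_[p] → ℂ} (hφ : Measurable φ) (hφ1 : ∀ x, ‖φ x‖ = 1) :
    HasSum (fun j ↦ ((p : ℂ)⁻¹ ^ n) ^ (k + j) * (1 - (p : ℂ)⁻¹ ^ n) *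
        ∫ y in {x : ℚ_[p] | ‖x‖ ≤ (p : ℝ) ^ (k + j)}, φ y ∂μ)
      (∫ y, (((max ((p : ℝ) ^ k) ‖y‖ : ℝ) : ℂ) ^ n)⁻¹ * φ y ∂μ) := by
  have hp : 1 < p := (Fact.out : p.Prime).one_lt
  have hp1 : (1 : ℝ) < p := by exact_mod_cast hp
  have hp0 : (p : ℝ) ≠ 0 := by positivity
  let c : ℕ → ℂ := fun j ↦ ((p : ℂ)⁻¹ ^ n) ^ (k + j) * (1 - (p : ℂ)⁻¹ ^ n)
  let B : ℕ → Set ℚ_[p] := fun j ↦ {x | ‖x‖ ≤ (p : ℝ) ^ (k + j)}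
  let F : ℕ → ℚ_[p] → ℂ := fun j ↦ (B j).indicator fun y ↦ c j * φ y
  have hB : ∀ j, MeasurableSet (B j) := fun j ↦ measurableSet_norm_le _
  have hBμ : ∀ j, μ (B j) = (p : ENNReal) ^ (k + j) := fun j ↦ measure_norm_le_pow μ hμ _
  have hF_int : ∀ j, Integrable (F j) μ := by
    intro j
    rw [integrable_indicator_iff (hB j)]
    refine Measure.integrableOn_of_bounded (M := ‖c j‖) ?_
      (measurable_const.mul hφ).aestronglyMeasurable (ae_of_all _ fun y ↦ ?_)
    · rw [hBμ]; exact ENNReal.pow_ne_top (ENNReal.natCast_ne_top p)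
    · rw [norm_mul, hφ1, mul_one]
  have hF_norm : ∀ j, ∫ y, ‖F j y‖ ∂μ = (p : ℝ) ^ (k + j) * ‖c j‖ := by
    intro j
    have : ∀ y, ‖F j y‖ = (B j).indicator (fun _ ↦ ‖c j‖) y := by
      intro y
      rw [norm_indicator_eq_indicator_norm]
      simp only [norm_mul, hφ1, mul_one]
    simp_rw [this]
    rw [integral_indicator (hB j), setIntegral_const, measureReal_def, hBμ]
    simp
  have hF_sum : Summable fun j ↦ ∫ y, ‖F j y‖ ∂μ := by
    simp_rw [hF_norm]
    have hq : (p : ℝ)⁻¹ ^ (n - 1) < 1 :=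
      pow_lt_one₀ (by positivity) (inv_lt_one_of_one_lt₀ hp1) (by omega)
    refine ((summable_geometric_of_lt_one (by positivity) hq).mul_left
      (((p : ℝ)⁻¹ ^ (n - 1)) ^ k * ‖1 - (p : ℂ)⁻¹ ^ n‖)).congr fun j ↦ ?_
    obtain ⟨l, rfl⟩ : ∃ l, n = l + 1 := ⟨n - 1, by omega⟩
    simp only [c, norm_mul, norm_pow, norm_inv, Complex.norm_natCast, Nat.add_sub_cancel]
    generalize ‖1 - (p : ℂ)⁻¹ ^ (l + 1)‖ = d
    rw [pow_succ _ l, mul_pow _ _ (k + j), inv_pow (p : ℝ) (k + j), pow_add _ k j]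
    field_simp
    rw [pow_add]
    ring
  have h := hasSum_integral_of_summable_integral_norm hF_int hF_sum
  convert! h using 1
  · ext j
    simp only [F]
    rw [integral_indicator (hB j), integral_const_mul]
  · congr 1
    ext y
    obtain ⟨m, hm⟩ := exists_pow_eq_max_one_norm y
    have h1 : (1 : ℝ) ≤ (p : ℝ) ^ k := one_le_pow₀ hp1.le
    have hmax : max ((p : ℝ) ^ k) ‖y‖ = max ((p : ℝ) ^ k) ((p : ℝ) ^ m) := by
      rw [← hm, ← max_assoc, max_eq_left h1]
    have hmem : ∀ j, y ∈ B j ↔ m ≤ k + j := by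
      intro j
      have h1 : (1 : ℝ) ≤ (p : ℝ) ^ (k + j) := one_le_pow₀ hp1.le
      rw [← pow_le_pow_iff_right₀ hp1, ← hm, max_le_iff]
      exact ⟨fun h ↦ ⟨h1, h⟩, fun h ↦ h.2⟩
    rw [hmax]
    symm
    refine HasSum.tsum_eq ?_
    convert! (hasSum_inv_max_pow hp (by omega : n ≠ 0) k m).mul_right (φ y) using 1
    ext j
    simp only [F, Set.indicator_apply, hmem, c]
    split_ifs <;> simp

variable {μ} in
theorem integral_inv_max_pow (hμ : μ {x : ℚ_[p] | ‖x‖ ≤ 1} = 1) {n : ℕ} (hn : 1 ≤ n) (k : ℕ) :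
    ∫ y, (((max ((p : ℝ) ^ k) ‖y‖ : ℝ) : ℂ) ^ (n + 1))⁻¹ ∂μ =
      (1 - (p : ℂ)⁻¹ ^ (n + 1)) / (1 - (p : ℂ)⁻¹ ^ n) * ((p : ℂ)⁻¹ ^ n) ^ k := by
  have hp1 : (1 : ℝ) < p := by exact_mod_cast (Fact.out : p.Prime).one_lt
  have hp0 : (p : ℂ) ≠ 0 := by exact_mod_cast (Fact.out : p.Prime).ne_zero
  have hq : ‖(p : ℂ)⁻¹ ^ n‖ < 1 := by
    rw [norm_pow, norm_inv, Complex.norm_natCast]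
    exact pow_lt_one₀ (by positivity) (inv_lt_one_of_one_lt₀ hp1) (by omega)
  have h := hasSum_integral_inv_max_pow_mul hμ (n := n + 1) (by omega) k
    (φ := fun _ ↦ 1) measurable_const (by simp)
  simp only [mul_one] at h
  refine h.unique ?_
  simp_rw [integral_norm_le_pow_one μ hμ]
  convert! (hasSum_geometric_of_norm_lt_one hq).mul_left
    ((1 - (p : ℂ)⁻¹ ^ (n + 1)) * ((p : ℂ)⁻¹ ^ n) ^ k) using 1
  · ext j
    rw [pow_succ _ n, mul_pow _ _ (k + j), inv_pow (p : ℂ) (k + j), pow_add _ k j]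
    field_simp
  · ring

variable {μ} in
theorem integrable_inv_max_pow (hμ : μ {x : ℚ_[p] | ‖x‖ ≤ 1} = 1) {n : ℕ} (hn : 1 ≤ n) (k : ℕ) :
    Integrable (fun y : ℚ_[p] ↦ (((max ((p : ℝ) ^ k) ‖y‖ : ℝ) : ℂ) ^ (n + 1))⁻¹) μ := by
  have hp0 : (p : ℂ) ≠ 0 := by exact_mod_cast (Fact.out : p.Prime).ne_zero
  have hq : ∀ m ≠ 0, 1 - (p : ℂ)⁻¹ ^ m ≠ 0 := by
    intro m hm h
    have := congrArg norm (sub_eq_zero.1 h)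
    rw [norm_one, norm_pow, norm_inv, Complex.norm_natCast, inv_pow] at this
    have h1 : (1 : ℝ) < (p : ℝ) ^ m :=
      one_lt_pow₀ (by exact_mod_cast (Fact.out : p.Prime).one_lt) hm
    exact (inv_lt_one_of_one_lt₀ h1).ne this.symm
  refine not_imp_comm.1 integral_undef ?_
  rw [integral_inv_max_pow hμ hn]
  exact mul_ne_zero (div_ne_zero (hq _ (by omega)) (hq _ (by omega)))
    (pow_ne_zero _ (pow_ne_zero _ (inv_ne_zero hp0)))

theorem setIntegral_addChar_eq_zero (χ : AddChar ℚ_[p] ℂ) {r : ℝ} {t : ℚ_[p]} (ht : ‖t‖ ≤ r)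
    (hχ : χ t ≠ 1) : ∫ y in {x : ℚ_[p] | ‖x‖ ≤ r}, χ y ∂μ = 0 := by
  have hmem : ∀ y : ℚ_[p], ‖y + t‖ ≤ r ↔ ‖y‖ ≤ r := by
    intro y
    refine ⟨fun h ↦ ?_, fun h ↦ (nonarchimedean y t).trans (max_le h ht)⟩
    have := nonarchimedean (y + t) (-t)
    rw [norm_neg, add_neg_cancel_right] at this
    exact this.trans (max_le h ht)
  rw [← integral_indicator (measurableSet_norm_le r)]
  set f : ℚ_[p] → ℂ := {x : ℚ_[p] | ‖x‖ ≤ r}.indicator fun y ↦ χ y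
  have h : ∀ y, f (y + t) = f y * χ t := by
    intro y
    simp only [f, Set.indicator_apply, Set.mem_ofPred_eq, hmem, AddChar.map_add_eq_mul]
    split_ifs <;> simp
  have h2 := integral_add_right_eq_self (μ := μ) f t
  simp_rw [h] at h2
  rw [integral_mul_const] at h2
  by_contra h0
  exact hχ (mul_left_cancel₀ h0 (h2.trans (mul_one _).symm))

variable {μ} in
theorem integral_height_mul_addChar (hμ : μ {x : ℚ_[p] | ‖x‖ ≤ 1} = 1) {ψ : AddChar ℚ_[p] ℂ}
    (hψ : ∀ x : ℚ_[p], ‖x‖ ≤ 1 → ψ x = 1) (a : ℚ_[p]) :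
    ∫ z : ℚ_[p] × ℚ_[p],
        (((max (max 1 ‖z.1‖) (max ‖z.2‖ ‖z.1 * z.2 - z.2 ^ 3‖)) ^ 2)⁻¹ : ℂ) *
          ψ (a * z.2) ∂(μ.prod μ) =
      (1 + (p : ℂ)⁻¹) * ∫ y, (((max ((p : ℝ) ^ 0) ‖y‖ : ℝ) : ℂ) ^ 3)⁻¹ * ψ (a * y) ∂μ := by
  have hp0 : (p : ℂ) ≠ 0 := by exact_mod_cast (Fact.out : p.Prime).ne_zero
  have hp1 : (p : ℂ) - 1 ≠ 0 := by
    rw [sub_ne_zero]; exact_mod_cast (Fact.out : p.Prime).ne_one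
  have hcont := continuous_addChar hψ
  set M : ℚ_[p] → ℝ := fun y ↦ max 1 ‖y‖
  have hfib : ∀ y : ℚ_[p], Integrable (fun x ↦ (((max (M y) ‖x‖ : ℝ) : ℂ) ^ 2)⁻¹) μ ∧
      ∫ x, (((max (M y) ‖x‖ : ℝ) : ℂ) ^ 2)⁻¹ ∂μ = (1 + (p : ℂ)⁻¹) * (M y : ℂ)⁻¹ := by
    intro y
    obtain ⟨k, hk⟩ := exists_pow_eq_max_one_norm y
    simp only [M, hk]
    refine ⟨integrable_inv_max_pow hμ le_rfl k, ?_⟩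
    rw [integral_inv_max_pow hμ le_rfl k]
    push_cast
    rw [pow_one, inv_pow, inv_pow]
    field_simp
    ring
  simp_rw [max_one_norm_height]
  set f : ℚ_[p] × ℚ_[p] → ℂ := fun z ↦
    (((M z.2 * max (M z.2) ‖z.1 - z.2 ^ 2‖ : ℝ) : ℂ) ^ 2)⁻¹ * ψ (a * z.2) with hf
  have hf_eq : ∀ y x, f (x, y) = ((M y : ℂ) ^ 2)⁻¹ * ψ (a * y) *
      (((max (M y) ‖x - y ^ 2‖ : ℝ) : ℂ) ^ 2)⁻¹ := by
    intro y x
    simp only [hf, Complex.ofReal_mul, mul_pow, mul_inv]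
    ring
  have hM : ∀ y, ‖(M y : ℂ)‖ = M y := fun y ↦ by
    rw [Complex.norm_real, Real.norm_of_nonneg (le_max_of_le_left zero_le_one)]
  have hnorm : ∀ y x, ((‖f (x, y)‖ : ℝ) : ℂ) = ((M y : ℂ) ^ 2)⁻¹ *
      (((max (M y) ‖x - y ^ 2‖ : ℝ) : ℂ) ^ 2)⁻¹ := by
    intro y x
    rw [hf_eq, norm_mul, norm_mul, norm_addChar_eq_one hψ, norm_inv, norm_inv, norm_pow, norm_pow,
      hM, Complex.norm_real, Real.norm_of_nonneg (le_max_of_le_right (norm_nonneg _))]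
    push_cast
    ring
  have hf_meas : Measurable f := by
    have h1 : Measurable fun z : ℚ_[p] × ℚ_[p] ↦ ψ (a * z.2) :=
      (hcont.comp (continuous_const.mul continuous_snd)).measurable
    have h2 : Continuous fun z : ℚ_[p] × ℚ_[p] ↦
        ((M z.2 * max (M z.2) ‖z.1 - z.2 ^ 2‖ : ℝ) : ℂ) ^ 2 := by fun_prop
    exact h2.measurable.inv.mul h1
  have hint : ∀ y, ∫ x, (((max (M y) ‖x - y ^ 2‖ : ℝ) : ℂ) ^ 2)⁻¹ ∂μ =
      (1 + (p : ℂ)⁻¹) * (M y : ℂ)⁻¹ := by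
    intro y
    rw [← (hfib y).2]
    exact integral_sub_right_eq_self (fun x ↦ (((max (M y) ‖x‖ : ℝ) : ℂ) ^ 2)⁻¹) (y ^ 2)
  have hf_int : Integrable f (μ.prod μ) := by
    rw [integrable_prod_iff' hf_meas.aestronglyMeasurable]
    constructor
    · refine ae_of_all _ fun y ↦ ?_
      simp_rw [hf_eq]
      exact ((hfib y).1.comp_sub_right (y ^ 2)).const_mul _
    · have h3 := (integrable_inv_max_pow hμ (n := 2) (by norm_num) 0).const_mul (1 + (p : ℂ)⁻¹)
      refine h3.re.congr (ae_of_all _ fun y ↦ ?_)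
      have : ((∫ x, ‖f (x, y)‖ ∂μ : ℝ) : ℂ) =
          (1 + (p : ℂ)⁻¹) * (((max ((p : ℝ) ^ 0) ‖y‖ : ℝ) : ℂ) ^ 3)⁻¹ := by
        rw [← integral_complex_ofReal]
        simp_rw [hnorm]
        rw [integral_const_mul, hint]
        simp only [M, pow_zero, pow_succ, mul_inv]
        ring
      simp only [Nat.reduceAdd]
      rw [← this]
      simp
  rw [integral_prod_symm _ hf_int, ← integral_const_mul]
  congr 1
  ext y
  simp_rw [hf_eq]
  rw [integral_const_mul, hint]
  simp only [M, pow_zero, pow_succ, mul_inv]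
  ring

end Padic

open Padic in
/-- For every prime p and integer a₂ with α = v_p(a₂), the local Fourier transform of
the height at s = 2 satisfies Ĥ_p(2; 0, a₂) = (1 + 1/p + 1/p²)(1 − 1/p^{2+2α})
(with the factor interpreted as 1 when a₂ = 0). -/
theorem local_fourier_height (p : ℕ) [Fact p.Prime]
    [MeasurableSpace ℚ_[p]] [BorelSpace ℚ_[p]]
    (μ : Measure ℚ_[p]) [μ.IsAddHaarMeasure] (hμ : μ {x : ℚ_[p] | ‖x‖ ≤ 1} = 1)
    (ψ : AddChar ℚ_[p] ℂ) (hψ1 : ∀ x : ℚ_[p], ‖x‖ ≤ 1 → ψ x = 1)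
    (hψ2 : ∃ x : ℚ_[p], ‖x‖ ≤ p ∧ ψ x ≠ 1) (a2 : ℤ) :
    (∀ α : ℕ, a2 ≠ 0 → (p : ℤ) ^ α ∣ a2 → ¬ (p : ℤ) ^ (α + 1) ∣ a2 →
      ∫ z : ℚ_[p] × ℚ_[p],
          (((max (max 1 ‖z.1‖) (max ‖z.2‖ ‖z.1 * z.2 - z.2 ^ 3‖)) ^ 2)⁻¹ : ℂ)
            * ψ ((a2 : ℚ_[p]) * z.2) ∂(μ.prod μ)
        = (1 + 1 / (p : ℂ) + 1 / (p : ℂ) ^ 2) * (1 - 1 / (p : ℂ) ^ (2 + 2 * α))) ∧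
    (a2 = 0 →
      ∫ z : ℚ_[p] × ℚ_[p],
          (((max (max 1 ‖z.1‖) (max ‖z.2‖ ‖z.1 * z.2 - z.2 ^ 3‖)) ^ 2)⁻¹ : ℂ)
            * ψ ((a2 : ℚ_[p]) * z.2) ∂(μ.prod μ)
        = 1 + 1 / (p : ℂ) + 1 / (p : ℂ) ^ 2) := by
  have hp1 : 1 < p := (Fact.out : p.Prime).one_lt
  have hpr : (0 : ℝ) < p := by exact_mod_cast hp1.pos
  have hp0 : (p : ℂ) ≠ 0 := by exact_mod_cast hp1.ne_zero
  have hsq : (p : ℂ) ^ 2 - 1 ≠ 0 := by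
    rw [sub_ne_zero]; exact_mod_cast (Nat.one_lt_pow two_ne_zero hp1).ne'
  rw [integral_height_mul_addChar hμ hψ1]
  refine ⟨fun α h0 hdvd hndvd ↦ ?_, ?_⟩
  · obtain ⟨x, hx, hψx⟩ := hψ2
    have ha : (a2 : ℚ_[p]) ≠ 0 := by exact_mod_cast h0
    have ha1 : ‖(a2 : ℚ_[p])‖ ≤ (p : ℝ) ^ (-α : ℤ) := (norm_int_le_pow_iff_dvd a2 α).2 hdvd
    have ha2 : (p : ℝ) ^ (-α : ℤ) ≤ ‖(a2 : ℚ_[p])‖ := by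
      rw [← norm_int_le_pow_iff_dvd, norm_le_pow_iff_norm_lt_pow_add_one, not_lt] at hndvd
      simpa using hndvd
    have hball : ∀ j, ∫ y in {y : ℚ_[p] | ‖y‖ ≤ (p : ℝ) ^ (0 + j)}, ψ (a2 * y) ∂μ =
        if j ∈ Finset.range (α + 1) then (p : ℂ) ^ j else 0 := by
      intro j
      rw [zero_add]
      split_ifs with hj
      · rw [← integral_norm_le_pow_one μ hμ]
        refine setIntegral_congr_fun (measurableSet_norm_le _) fun y hy ↦ hψ1 _ ?_
        rw [norm_mul]
        calc _ ≤ (p : ℝ) ^ (-α : ℤ) * (p : ℝ) ^ α := by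
              gcongr
              exact (Set.mem_ofPred_eq ▸ hy : ‖y‖ ≤ _).trans
                (pow_le_pow_right₀ (by exact_mod_cast hp1.le) (by simpa using hj))
          _ = 1 := by rw [zpow_neg, zpow_natCast, inv_mul_cancel₀ (by positivity)]
      · refine setIntegral_addChar_eq_zero μ (ψ.mulShift (a2 : ℚ_[p])) (t := x / a2) ?_ ?_
        · rw [norm_div, div_le_iff₀ (norm_pos_iff.2 ha)]
          calc ‖x‖ ≤ (p : ℝ) ^ (α + 1) * (p : ℝ) ^ (-α : ℤ) := by
                rw [zpow_neg, zpow_natCast, pow_succ]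
                field_simp
                exact hx
            _ ≤ _ := by
                gcongr
                · exact_mod_cast hp1.le
                · simpa using hj
        · rwa [AddChar.mulShift_apply, mul_div_cancel₀ _ ha]
    have hsum := hasSum_integral_inv_max_pow_mul hμ (n := 3) (by norm_num) 0
      (φ := fun y ↦ ψ (a2 * y))
      ((continuous_addChar hψ1).comp (continuous_const.mul continuous_id)).measurable
      (fun _ ↦ norm_addChar_eq_one hψ1 _)
    simp_rw [hball] at hsum
    rw [hsum.unique (hasSum_sum_of_ne_finset_zero fun j hj ↦ by rw [if_neg hj, mul_zero])]
    have hgeom : ∀ j ∈ Finset.range (α + 1), ((p : ℂ)⁻¹ ^ 3) ^ (0 + j) * (1 - (p : ℂ)⁻¹ ^ 3) *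
        (if j ∈ Finset.range (α + 1) then (p : ℂ) ^ j else 0) =
          (1 - (p : ℂ)⁻¹ ^ 3) * ((p : ℂ)⁻¹ ^ 2) ^ j := by
      intro j hj
      rw [if_pos hj, zero_add, pow_succ _ 2, mul_pow, inv_pow (p : ℂ) j]
      field_simp
    have hq : (p : ℂ)⁻¹ ^ 2 ≠ 1 := by
      rw [inv_pow, ne_eq, inv_eq_one]
      exact sub_ne_zero.1 hsq
    rw [Finset.sum_congr rfl hgeom, ← Finset.mul_sum, geom_sum_eq hq,
      show 2 + 2 * α = 2 * (α + 1) by ring, pow_mul, inv_pow, inv_pow, inv_pow]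
    have hq' : 1 - (p : ℂ) ^ 2 ≠ 0 := by rwa [← neg_sub, neg_ne_zero]
    generalize ((p : ℂ) ^ 2) ^ (α + 1) = r
    rw [one_div r]
    field_simp
    ring
  · rintro rfl
    simp only [Int.cast_zero, zero_mul, AddChar.map_zero_eq_one, mul_one]
    have h := integral_inv_max_pow hμ (n := 2) (by norm_num) 0
    simp only [Nat.reduceAdd] at h
    rw [h, inv_pow, inv_pow, pow_zero]
    field_simp
    ring
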